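/- In the Lie algebra 𝔩 = sl(2,ℝ) ⋉ ℝ³ (with sl(2,ℝ) acting on ℝ³ via the adjoint representation under the identification ℝ³ ≅ sl(2,ℝ)), equipped with J(Eᵢ) = E_{i+3}, J(E_{i+3}) = -Eᵢ for i=1,2,3 (Eᵢ in sl(2,ℝ), E_{i+3} in ℝ³), the Nijenhuis expression satisfies N_J(E₁,E₂) = 2E₃ ≠ 0; hence J does not define an integrable structure. -/

import Mathlib

noncomputable section

/-- `sl(2,ℝ)`: traceless 2×2 real matrices with the commutator bracket. -/
abbrev sl2 := LieAlgebra.SpecialLinear.sl (Fin 2) ℝ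

/-- Construct an element of `sl(2,ℝ)` from a traceless matrix. -/
def mksl (A : Matrix (Fin 2) (Fin 2) ℝ) (h : A.trace = 0) : sl2 :=
  ⟨A, show _ ∈ LinearMap.ker (Matrix.traceLinearMap (Fin 2) ℝ ℝ) from LinearMap.mem_ker.2 h⟩

def X1 : sl2 := mksl !![1,0;0,-1] (by simp [Matrix.trace_fin_two])
def X2 : sl2 := mksl !![0,1;1,0] (by simp [Matrix.trace_fin_two])
def X3 : sl2 := mksl !![0,1;-1,0] (by simp [Matrix.trace_fin_two])

theorem lie_X1_X2 : ⁅X1, X2⁆ = (2 : ℝ) • X3 := by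
  apply Subtype.ext
  change X1.1 * X2.1 - X2.1 * X1.1 = (2 : ℝ) • X3.1
  ext i j
  fin_cases i <;> fin_cases j <;> norm_num [X1, X2, X3, mksl]

theorem X3_ne_zero : X3 ≠ 0 := by
  intro h
  have h01 := congrFun (congrFun (congrArg Subtype.val h) 0) 1
  simp [X3, mksl] at h01

/-- In $\mathfrak l = \mathfrak{sl}(2,\mathbb R)\ltimes\mathbb R^3$ (with $\mathbb R^3$
identified with $\mathfrak{sl}(2,\mathbb R)$ and the adjoint action), with
$J(E_i)=E_{i+3}$, $J(E_{i+3})=-E_i$, the Nijenhuis expression satisfies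
$N_J(E_1,E_2)=2E_3\ne 0$; hence $J$ is not integrable. -/
theorem sl2_semidirect_J_not_integrable :
    ∀ br : (sl2 × sl2) → (sl2 × sl2) → (sl2 × sl2),
      br = (fun x y => (⁅x.1, y.1⁆, ⁅x.1, y.2⁆ - ⁅y.1, x.2⁆)) →
      ∀ J : (sl2 × sl2) → (sl2 × sl2), J = (fun p => (-p.2, p.1)) →
      ∀ E₁ E₂ E₃ : sl2 × sl2, E₁ = (X1, 0) → E₂ = (X2, 0) → E₃ = (X3, 0) →
      br (J E₁) (J E₂) - br E₁ E₂ - J (br (J E₁) E₂) - J (br E₁ (J E₂)) = (2:ℝ) • E₃ ∧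
      br (J E₁) (J E₂) - br E₁ E₂ - J (br (J E₁) E₂) - J (br E₁ (J E₂)) ≠ 0 := by
  rintro br rfl J rfl E₁ E₂ E₃ rfl rfl rfl
  have hskew : ⁅X2, X1⁆ = -((2 : ℝ) • X3) := by rw [← lie_skew, lie_X1_X2]
  have hne : (2 : ℝ) • (X3, (0 : sl2)) ≠ 0 :=
    smul_ne_zero two_ne_zero fun h => X3_ne_zero (congrArg Prod.fst h)
  refine and_iff_left_of_imp (fun h => h.trans_ne hne) |>.mpr ?_
  ext1 <;> simp [lie_X1_X2, hskew]
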